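/- Ξ₁₂ is a subgroup of both Γ' and SL(2,ℤ[i]); the index of Ξ₁₂ in Γ' is 6, and the index of Ξ₁₂ in SL(2,ℤ[i]) is 3. -/

import Mathlib

open Complex Matrix

noncomputable section

/-- `z ∈ ℤ[i] ⊆ ℂ`. -/
def IsGauss (z : ℂ) : Prop := ∃ a b : ℤ, z = (a : ℂ) + (b : ℂ) * Complex.I

/-- Divisibility in `ℤ[i]`. -/
def GDvd (m z : ℂ) : Prop := ∃ k : ℂ, IsGauss k ∧ z = m * k

/-- Congruence modulo `m` in `ℤ[i]`. -/
def GCong (m z w : ℂ) : Prop := GDvd m (z - w)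

/-- The matrix of the conjugation action of `g ∈ SL(2,ℂ)` on `sl₂(ℂ)` in the trace-form
orthonormal basis. -/
def CMat (g : Matrix (Fin 2) (Fin 2) ℂ) : Matrix (Fin 3) (Fin 3) ℂ :=
  !![(g 0 0 ^ 2 - g 1 0 ^ 2 + g 1 1 ^ 2 - g 0 1 ^ 2) / 2,
     Complex.I * (g 0 0 ^ 2 - g 1 0 ^ 2 + g 0 1 ^ 2 - g 1 1 ^ 2) / 2,
     g 1 0 * g 1 1 - g 0 0 * g 0 1;
     Complex.I * (g 0 1 ^ 2 + g 1 1 ^ 2 - g 0 0 ^ 2 - g 1 0 ^ 2) / 2,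
     (g 0 0 ^ 2 + g 1 0 ^ 2 + g 0 1 ^ 2 + g 1 1 ^ 2) / 2,
     Complex.I * (g 0 0 * g 0 1 + g 1 0 * g 1 1);
     -(g 0 0 * g 1 0) + g 0 1 * g 1 1,
     Complex.I * (g 0 0 * g 1 0 + g 0 1 * g 1 1),
     g 0 0 * g 1 1 + g 0 1 * g 1 0]

/-- `Ξ₁₂` as a subset of `SL(2,ℂ)`: Gaussian-entry matrices reducing mod `1+i` to
`!![1,0;0,1]` or `!![0,1;1,0]`. -/
def Xi12SL : Set (Matrix.SpecialLinearGroup (Fin 2) ℂ) :=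
  {g | (∀ i j, IsGauss ((g : Matrix (Fin 2) (Fin 2) ℂ) i j)) ∧
    ((GCong (1 + Complex.I) ((g : Matrix (Fin 2) (Fin 2) ℂ) 0 0) 1 ∧
      GCong (1 + Complex.I) ((g : Matrix (Fin 2) (Fin 2) ℂ) 0 1) 0 ∧
      GCong (1 + Complex.I) ((g : Matrix (Fin 2) (Fin 2) ℂ) 1 0) 0 ∧
      GCong (1 + Complex.I) ((g : Matrix (Fin 2) (Fin 2) ℂ) 1 1) 1) ∨
     (GCong (1 + Complex.I) ((g : Matrix (Fin 2) (Fin 2) ℂ) 0 0) 0 ∧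
      GCong (1 + Complex.I) ((g : Matrix (Fin 2) (Fin 2) ℂ) 0 1) 1 ∧
      GCong (1 + Complex.I) ((g : Matrix (Fin 2) (Fin 2) ℂ) 1 0) 1 ∧
      GCong (1 + Complex.I) ((g : Matrix (Fin 2) (Fin 2) ℂ) 1 1) 0))}

/-- `Γ'` as a subset of `SL(2,ℂ)`: the preimage under `C` of `SO(3,ℤ[i])`. -/
def GammaSL : Set (Matrix.SpecialLinearGroup (Fin 2) ℂ) :=
  {g | ∀ i j, IsGauss (CMat (g : Matrix (Fin 2) (Fin 2) ℂ) i j)}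

/-- `SL(2,ℤ[i])` as a subset of `SL(2,ℂ)`. -/
def SL2ZiSL : Set (Matrix.SpecialLinearGroup (Fin 2) ℂ) :=
  {g | ∀ i j, IsGauss ((g : Matrix (Fin 2) (Fin 2) ℂ) i j)}

open GaussianInt in
theorem isGauss_iff {z : ℂ} : IsGauss z ↔ ∃ x : GaussianInt, toComplex x = z := by
  constructor
  · rintro ⟨a, b, rfl⟩
    exact ⟨⟨a, b⟩, by rw [toComplex_def]⟩
  · rintro ⟨x, rfl⟩
    exact ⟨x.re, x.im, toComplex_def x⟩

open GaussianInt in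
theorem isGauss_toComplex (x : GaussianInt) : IsGauss (toComplex x) := isGauss_iff.2 ⟨x, rfl⟩

theorem IsGauss.add {z w : ℂ} (hz : IsGauss z) (hw : IsGauss w) : IsGauss (z + w) := by
  obtain ⟨x, rfl⟩ := isGauss_iff.1 hz
  obtain ⟨y, rfl⟩ := isGauss_iff.1 hw
  exact isGauss_iff.2 ⟨x + y, map_add _ _ _⟩

theorem IsGauss.mul {z w : ℂ} (hz : IsGauss z) (hw : IsGauss w) : IsGauss (z * w) := by
  obtain ⟨x, rfl⟩ := isGauss_iff.1 hz
  obtain ⟨y, rfl⟩ := isGauss_iff.1 hw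
  exact isGauss_iff.2 ⟨x * y, map_mul _ _ _⟩

theorem IsGauss.neg {z : ℂ} (hz : IsGauss z) : IsGauss (-z) := by
  obtain ⟨x, rfl⟩ := isGauss_iff.1 hz
  exact isGauss_iff.2 ⟨-x, map_neg _ _⟩

theorem isGauss_I : IsGauss I := ⟨0, 1, by simp⟩

theorem isGauss_zero : IsGauss 0 := ⟨0, 0, by simp⟩

theorem isGauss_one : IsGauss 1 := ⟨1, 0, by simp⟩

namespace GaussianInt

/-- The imaginary unit as a Gaussian integer. -/
def imag : GaussianInt := ⟨0, 1⟩

theorem imag_mul_imag : imag * imag = -1 := by decide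

@[simp]
theorem toComplex_imag : toComplex imag = I := by simp [imag, toComplex_def]

/-- Reduction of Gaussian integers modulo `1 + i`. -/
def parity : GaussianInt →+* ZMod 2 := Zsqrtd.lift ⟨1, by decide⟩

theorem parity_apply (x : GaussianInt) : parity x = (x.re : ZMod 2) + x.im := by
  simp [parity, Zsqrtd.lift]

@[simp]
theorem parity_imag : parity imag = 1 := by simp [parity_apply, imag]

@[simp]
theorem parity_two : parity 2 = 0 := by
  rw [map_ofNat]; decide

theorem parity_eq_zero_iff {x : GaussianInt} : parity x = 0 ↔ ∃ k, x = (1 + imag) * k := by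
  constructor
  · intro h
    rw [parity_apply, ← Int.cast_add, ZMod.intCast_zmod_eq_zero_iff_dvd] at h
    obtain ⟨t, ht⟩ := h
    refine ⟨⟨t, x.im - t⟩, ?_⟩
    ext <;> simp [imag]
    push_cast at ht
    linarith
  · rintro ⟨k, rfl⟩
    have : (1 + 1 : ZMod 2) = 0 := by decide
    simp [this]

theorem parity_eq_zero_or_one (x : GaussianInt) : parity x = 0 ∨ parity x = 1 := by
  generalize parity x = p
  revert p; decide

theorem gcong_toComplex_iff {x y : GaussianInt} :
    GCong (1 + I) (toComplex x) (toComplex y) ↔ parity x = parity y := by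
  rw [← sub_eq_zero, ← map_sub, parity_eq_zero_iff]
  constructor
  · rintro ⟨k, hk, h⟩
    obtain ⟨k, rfl⟩ := isGauss_iff.1 hk
    exact ⟨k, toComplex_injective (by simpa using h)⟩
  · rintro ⟨k, h⟩
    exact ⟨toComplex k, isGauss_toComplex k, by simpa using congrArg toComplex h⟩

theorem gcong_toComplex_zero_iff {x : GaussianInt} :
    GCong (1 + I) (toComplex x) 0 ↔ parity x = 0 := by
  simpa using gcong_toComplex_iff (x := x) (y := 0)

theorem gcong_toComplex_one_iff {x : GaussianInt} :
    GCong (1 + I) (toComplex x) 1 ↔ parity x = 1 := by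
  simpa using gcong_toComplex_iff (x := x) (y := 1)

theorem unit_cases {u : GaussianInt} (hu : IsUnit u) :
    ∃ e : GaussianInt, u = e ^ 2 ∨ u = imag * e ^ 2 := by
  have h := (Zsqrtd.norm_eq_one_iff' (by norm_num) u).2 hu
  rw [Zsqrtd.norm_def] at h
  obtain ⟨m, n⟩ := u
  simp only at h
  have hm : -1 ≤ m ∧ m ≤ 1 := by constructor <;> nlinarith [mul_self_nonneg n]
  have hn : -1 ≤ n ∧ n ≤ 1 := by constructor <;> nlinarith [mul_self_nonneg m]
  obtain ⟨hm₁, hm₂⟩ := hm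
  obtain ⟨hn₁, hn₂⟩ := hn
  interval_cases m <;> interval_cases n <;> simp at h
  · exact ⟨imag, Or.inl (by decide)⟩
  · exact ⟨imag, Or.inr (by decide)⟩
  · exact ⟨1, Or.inr (by decide)⟩
  · exact ⟨1, Or.inl (by decide)⟩

theorem eq_sq_or_eq_imag_mul_sq {α β γ : GaussianInt} (h : IsCoprime α β) (hγ : α * β = γ ^ 2) :
    ∃ s, α = s ^ 2 ∨ α = imag * s ^ 2 := by
  obtain ⟨d, u, hu⟩ := exists_associated_pow_of_mul_eq_pow' h hγ
  obtain ⟨e, he | he⟩ := unit_cases u.isUnit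
  · exact ⟨d * e, Or.inl (by rw [← hu, he]; ring)⟩
  · exact ⟨d * e, Or.inr (by rw [← hu, he]; ring)⟩

theorem imag_not_square (j : GaussianInt) : j ^ 2 ≠ imag := by
  intro h
  have h2 := congrArg Zsqrtd.im h
  simp only [sq, imag, Zsqrtd.im_mul] at h2
  rw [mul_comm j.im] at h2
  generalize j.re * j.im = n at h2
  omega

theorem eq_zero_of_sq_eq_imag_mul_sq {k m : GaussianInt} (h : k ^ 2 = imag * m ^ 2) : m = 0 := by
  by_contra hm
  obtain ⟨j, rfl⟩ : m ∣ k := by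
    rw [← IsIntegrallyClosed.pow_dvd_pow_iff (n := 2) two_ne_zero]
    exact ⟨imag, by rw [h, mul_comm]⟩
  refine imag_not_square j (mul_left_cancel₀ (pow_ne_zero 2 hm) ?_)
  linear_combination h

theorem one_add_imag_ne_zero : (1 + imag : GaussianInt) ≠ 0 := by decide

end GaussianInt

theorem IsGauss.of_two_mul_of_sq {z : ℂ} (h : IsGauss (2 * z)) (h2 : IsGauss (z ^ 2)) :
    IsGauss z := by
  obtain ⟨x, hx⟩ := isGauss_iff.1 h
  obtain ⟨y, hy⟩ := isGauss_iff.1 h2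
  obtain ⟨k, rfl⟩ : 2 ∣ x := by
    rw [← IsIntegrallyClosed.pow_dvd_pow_iff (n := 2) two_ne_zero]
    refine ⟨y, GaussianInt.toComplex_injective ?_⟩
    simp only [map_pow, map_mul, map_ofNat, hx, hy]
    ring
  refine isGauss_iff.2 ⟨k, ?_⟩
  rw [map_mul, map_ofNat] at hx
  exact mul_left_cancel₀ two_ne_zero hx

open GaussianInt in
/-- If `x² ± y²` are odd Gaussian integers and `2xy` is an even one, then `x²`, `y²`, `xy` are
Gaussian integers. -/
theorem isGauss_of_odd {x y : ℂ} {p q r : GaussianInt} (hp : x ^ 2 - y ^ 2 = toComplex p)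
    (hq : x ^ 2 + y ^ 2 = toComplex q) (hr : 2 * (x * y) = toComplex r)
    (pp : parity p = 1) (pq : parity q = 1) (pr : parity r = 0) :
    IsGauss (x ^ 2) ∧ IsGauss (y ^ 2) ∧ IsGauss (x * y) := by
  have h11 : (1 + 1 : ZMod 2) = 0 := by decide
  obtain ⟨r, rfl⟩ := parity_eq_zero_iff.1 pr
  obtain ⟨e, he⟩ := parity_eq_zero_iff.1 (show parity (q + p) = 0 by rw [map_add, pp, pq, h11])
  obtain ⟨f, hf⟩ := parity_eq_zero_iff.1 (show parity (q - p) = 0 by rw [map_sub, pp, pq, sub_self])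
  have hef : e * f = r ^ 2 := by
    refine mul_left_cancel₀ (pow_ne_zero 2 one_add_imag_ne_zero) ?_
    have : (q + p) * (q - p) = ((1 + imag) * r) ^ 2 := by
      apply toComplex_injective
      simp only [map_pow, map_mul, map_add, map_sub, ← hp, ← hq] at hr ⊢
      rw [← hr]; ring
    rw [he, hf] at this
    linear_combination this
  have hsub : e = f + (1 - imag) * p := by
    refine mul_left_cancel₀ one_add_imag_ne_zero ?_
    linear_combination hf - he + p * imag_mul_imag
  have hpar : parity e = parity f := by rw [hsub]; simp
  have hpr : parity r = 0 := by
    refine (parity_eq_zero_or_one r).resolve_right fun h1 ↦ ?_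
    have hf1 : parity f = 1 := by
      have := congrArg parity hef
      rw [map_mul, map_pow, hpar, h1] at this
      refine (parity_eq_zero_or_one f).resolve_left fun h0 ↦ ?_
      rw [h0] at this
      exact absurd this (by decide)
    obtain ⟨k, hk⟩ := parity_eq_zero_iff.1
      (show parity (r - f) = 0 by rw [map_sub, h1, hf1, sub_self])
    have key : (1 + imag) * (k * (k + (1 - imag) * f)) = -imag * p * f := by
      refine mul_left_cancel₀ one_add_imag_ne_zero ?_
      have hr' : r = f + (1 + imag) * k := by linear_combination hk
      rw [hsub, hr'] at hef
      linear_combination -hef + (p * f - k * f - imag * k * f) * imag_mul_imag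
    have := congrArg parity key
    simp [h11, pp, hf1] at this
  have he0 : parity e = 0 := by
    have := congrArg parity hef
    rw [map_mul, map_pow, ← hpar, hpr] at this
    simpa using this
  obtain ⟨e, rfl⟩ := parity_eq_zero_iff.1 he0
  obtain ⟨f, rfl⟩ := parity_eq_zero_iff.1 (hpar ▸ he0)
  obtain ⟨r, rfl⟩ := parity_eq_zero_iff.1 hpr
  have he := congrArg toComplex he
  have hf := congrArg toComplex hf
  simp only [map_add, map_sub, map_mul, map_one, toComplex_imag, ← hp, ← hq] at he hf hr
  refine ⟨isGauss_iff.2 ⟨imag * e, ?_⟩, isGauss_iff.2 ⟨imag * f, ?_⟩, isGauss_iff.2 ⟨imag * r, ?_⟩⟩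
    <;> simp only [map_mul, toComplex_imag]
  · linear_combination -he / 2 - toComplex e * I_sq / 2
  · linear_combination -hf / 2 - toComplex f * I_sq / 2
  · linear_combination -hr / 2 - toComplex r * I_sq / 2

open GaussianInt in
theorem isGauss_or_eq_mul {ζ x y c d : ℂ} (hζ : ζ ^ 2 = I) (hx : IsGauss (x ^ 2))
    (hy : IsGauss (y ^ 2)) (hxy : IsGauss (x * y)) (hc : IsGauss (c ^ 2)) (hd : IsGauss (d ^ 2))
    (hcd : IsGauss (c * d)) (hdet : (x * d - y * c) ^ 2 = 1) :
    IsGauss x ∨ ∃ s, IsGauss s ∧ x = ζ * s := by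
  obtain ⟨α, hα⟩ := isGauss_iff.1 hx
  obtain ⟨β, hβ⟩ := isGauss_iff.1 hy
  obtain ⟨γ, hγ⟩ := isGauss_iff.1 hxy
  obtain ⟨v, hv⟩ := isGauss_iff.1 hc
  obtain ⟨u, hu⟩ := isGauss_iff.1 hd
  obtain ⟨w, hw⟩ := isGauss_iff.1 hcd
  have hsq : α * β = γ ^ 2 := toComplex_injective (by simp only [map_mul, map_pow, *]; ring)
  have hone : u * α + v * β - 2 * w * γ = 1 := by
    apply toComplex_injective
    simp only [map_add, map_sub, map_mul, map_one, map_ofNat, *]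
    linear_combination hdet
  have hcop : IsCoprime α β :=
    ⟨u ^ 2 * α + 2 * u * v * β - 4 * u * w * γ + 4 * w ^ 2 * β, v ^ 2 * β - 4 * v * w * γ, by
      linear_combination (u * α + v * β - 2 * w * γ + 1) * hone + 4 * w ^ 2 * hsq⟩
  obtain ⟨s, rfl | rfl⟩ := eq_sq_or_eq_imag_mul_sq hcop hsq
  · left
    rw [map_pow, sq_eq_sq_iff_eq_or_eq_neg] at hα
    obtain h | h := hα
    · exact isGauss_iff.2 ⟨s, h⟩
    · exact isGauss_iff.2 ⟨-s, by rw [map_neg, h, neg_neg]⟩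
  · right
    rw [map_mul, map_pow, toComplex_imag, ← hζ, ← mul_pow, sq_eq_sq_iff_eq_or_eq_neg] at hα
    obtain h | h := hα
    · exact ⟨_, isGauss_toComplex s, h.symm⟩
    · exact ⟨_, isGauss_toComplex (-s), by rw [map_neg, mul_neg, h, neg_neg]⟩

open GaussianInt in
theorem IsGauss.eq_zero_of_mul {ζ x s : ℂ} (hζ : ζ ^ 2 = I) (hx : IsGauss x) (hs : IsGauss s)
    (h : IsGauss (x * (ζ * s))) : x = 0 ∨ s = 0 := by
  obtain ⟨x, rfl⟩ := isGauss_iff.1 hx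
  obtain ⟨s, rfl⟩ := isGauss_iff.1 hs
  obtain ⟨k, hk⟩ := isGauss_iff.1 h
  have := eq_zero_of_sq_eq_imag_mul_sq (k := k) (m := x * s) (toComplex_injective (by
    simp only [map_mul, map_pow, toComplex_imag, hk, ← hζ]; ring))
  rw [← mul_eq_zero, ← map_mul, this, map_zero]

/-- If all products of two entries of `g ∈ SL(2,ℂ)` are Gaussian integers, then either `g` has
Gaussian entries, or `g` is `√i` times a matrix with Gaussian entries. -/
theorem entries_isGauss_or {ζ : ℂ} (hζ : ζ ^ 2 = I) (g : SpecialLinearGroup (Fin 2) ℂ)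
    (h : ∀ i j k l, IsGauss (g i j * g k l)) :
    (∀ i j, IsGauss (g i j)) ∨ ∀ i j, ∃ s, IsGauss s ∧ g i j = ζ * s := by
  have hdet : g 0 0 * g 1 1 - g 0 1 * g 1 0 = 1 := by
    rw [← det_fin_two]; exact g.det_coe
  have h2 (i j) : IsGauss (g i j ^ 2) := by rw [sq]; exact h i j i j
  have key : ∀ i j, IsGauss (g i j) ∨ ∃ s, IsGauss s ∧ g i j = ζ * s := by
    have H (i j k l) (hd : (g i j * g k l - g i l * g k j) ^ 2 = 1) :
        IsGauss (g i j) ∨ ∃ s, IsGauss s ∧ g i j = ζ * s :=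
      isGauss_or_eq_mul hζ (h2 _ _) (h2 _ _) (h _ _ _ _) (h2 _ _) (h2 _ _) (h _ _ _ _) hd
    have hdet2 : (g 0 0 * g 1 1 - g 0 1 * g 1 0) ^ 2 = 1 := by rw [hdet, one_pow]
    simp only [Fin.forall_fin_two]
    refine ⟨⟨H 0 0 1 1 ?_, H 0 1 1 0 ?_⟩, H 1 0 0 1 ?_, H 1 1 0 0 ?_⟩ <;>
      linear_combination hdet2
  by_cases hG : ∀ i j, IsGauss (g i j)
  · exact Or.inl hG
  push Not at hG
  obtain ⟨i, j, hij⟩ := hG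
  obtain ⟨s, hs, hgs⟩ := (key i j).resolve_left hij
  refine Or.inr fun k l ↦ (key k l).elim (fun hkl ↦ ⟨0, isGauss_zero, ?_⟩) id
  have h0 := h k l i j
  rw [hgs] at h0
  rw [mul_zero]
  refine (hkl.eq_zero_of_mul hζ hs h0).resolve_right ?_
  rintro rfl
  exact hij (by rw [hgs, mul_zero]; exact isGauss_zero)

/-- The matrix of the conjugation action of `g` on `sl₂(ℂ)` in the basis `X₁, X₂, Y`. It differs
from `CMat g` by the sign of one entry, which makes it multiplicative in `g`. -/
def conjMat (g : Matrix (Fin 2) (Fin 2) ℂ) : Matrix (Fin 3) (Fin 3) ℂ :=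
  !![(g 0 0 ^ 2 - g 1 0 ^ 2 + g 1 1 ^ 2 - g 0 1 ^ 2) / 2,
     I * (g 0 0 ^ 2 - g 1 0 ^ 2 + g 0 1 ^ 2 - g 1 1 ^ 2) / 2,
     g 1 0 * g 1 1 - g 0 0 * g 0 1;
     I * (g 0 1 ^ 2 + g 1 1 ^ 2 - g 0 0 ^ 2 - g 1 0 ^ 2) / 2,
     (g 0 0 ^ 2 + g 1 0 ^ 2 + g 0 1 ^ 2 + g 1 1 ^ 2) / 2,
     I * (g 0 0 * g 0 1 + g 1 0 * g 1 1);
     -(g 0 0 * g 1 0) + g 0 1 * g 1 1,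
     -(I * (g 0 0 * g 1 0 + g 0 1 * g 1 1)),
     g 0 0 * g 1 1 + g 0 1 * g 1 0]

theorem isGauss_neg_iff {z : ℂ} : IsGauss (-z) ↔ IsGauss z :=
  ⟨fun h ↦ neg_neg z ▸ h.neg, IsGauss.neg⟩

theorem mem_GammaSL_iff {g : SpecialLinearGroup (Fin 2) ℂ} :
    g ∈ GammaSL ↔ ∀ i j, IsGauss (conjMat g i j) := by
  change (∀ i j, IsGauss (CMat g i j)) ↔ _
  simp [Fin.forall_fin_succ, CMat, conjMat, isGauss_neg_iff]

theorem conjMat_mul (g h : Matrix (Fin 2) (Fin 2) ℂ) : conjMat (g * h) = conjMat g * conjMat h := by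
  ext i j
  fin_cases i <;> fin_cases j <;>
    simp [conjMat, Matrix.mul_apply, Fin.sum_univ_two, Fin.sum_univ_three] <;> ring_nf <;>
    simp only [I_sq] <;> ring

theorem conjMat_one : conjMat 1 = 1 := by
  ext i j
  fin_cases i <;> fin_cases j <;> simp [conjMat]

theorem conjMat_inv (g : SpecialLinearGroup (Fin 2) ℂ) :
    conjMat (g⁻¹ : SpecialLinearGroup (Fin 2) ℂ) = (conjMat g)ᵀ := by
  rw [Matrix.SpecialLinearGroup.coe_inv, adjugate_fin_two]
  ext i j
  fin_cases i <;> fin_cases j <;> simp [conjMat] <;> ring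

theorem index_eq_natCard_of_existsUnique {G ι : Type*} [Group G] (H : Subgroup G) (f : ι → G)
    (h : ∀ g, ∃! i, (f i)⁻¹ * g ∈ H) : H.index = Nat.card ι := by
  refine (Nat.card_eq_of_bijective (fun i ↦ (f i : G ⧸ H)) ⟨fun i j hij ↦ ?_, fun q ↦ ?_⟩).symm
  · exact (h (f j)).unique (QuotientGroup.eq.1 hij) (by simp)
  · induction q using QuotientGroup.induction_on with
    | H g => exact (h g).exists.imp fun i hi ↦ QuotientGroup.eq.2 hi

/-- The subgroup `Γ'` of `SL(2,ℂ)`. -/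
def gammaSubgroup : Subgroup (SpecialLinearGroup (Fin 2) ℂ) where
  carrier := GammaSL
  one_mem' := by
    rw [mem_GammaSL_iff, Matrix.SpecialLinearGroup.coe_one, conjMat_one]
    intro i j
    rw [Matrix.one_apply]
    split_ifs
    exacts [isGauss_one, isGauss_zero]
  mul_mem' {g h} hg hh := by
    rw [mem_GammaSL_iff] at *
    intro i j
    rw [Matrix.SpecialLinearGroup.coe_mul, conjMat_mul, Matrix.mul_apply, Fin.sum_univ_three]
    exact (((hg _ _).mul (hh _ _)).add ((hg _ _).mul (hh _ _))).add ((hg _ _).mul (hh _ _))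
  inv_mem' {g} hg := by
    rw [mem_GammaSL_iff] at *
    intro i j
    rw [conjMat_inv]
    exact hg j i

open GaussianInt

theorem mem_gammaSubgroup_iff {g : SpecialLinearGroup (Fin 2) ℂ} :
    g ∈ gammaSubgroup ↔ ∃ N : Matrix (Fin 3) (Fin 3) GaussianInt,
      toComplex.mapMatrix N = conjMat g := by
  refine mem_GammaSL_iff.trans ⟨fun h ↦ ?_, ?_⟩
  · choose N hN using fun i j ↦ isGauss_iff.1 (h i j)
    exact ⟨N, by ext i j; exact hN i j⟩
  · rintro ⟨N, hN⟩ i j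
    rw [← hN]
    exact isGauss_toComplex _

theorem mapMatrix_toComplex_injective {n : Type*} [Fintype n] [DecidableEq n] :
    Function.Injective (toComplex.mapMatrix : Matrix n n GaussianInt →+* Matrix n n ℂ) :=
  Matrix.map_injective toComplex_injective

/-- The matrix over `ℤ[i]` of an element of `Γ'`. -/
def gammaMat (g : gammaSubgroup) : Matrix (Fin 3) (Fin 3) GaussianInt :=
  (mem_gammaSubgroup_iff.1 g.2).choose

theorem mapMatrix_gammaMat (g : gammaSubgroup) : toComplex.mapMatrix (gammaMat g) = conjMat g.1 :=
  (mem_gammaSubgroup_iff.1 g.2).choose_spec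

/-- The representation of `Γ'` on `ℤ[i]³`. -/
def gammaRep : gammaSubgroup →* Matrix (Fin 3) (Fin 3) GaussianInt where
  toFun := gammaMat
  map_one' := mapMatrix_toComplex_injective <| by
    rw [mapMatrix_gammaMat, map_one]
    exact conjMat_one
  map_mul' g h := mapMatrix_toComplex_injective <| by
    rw [map_mul, mapMatrix_gammaMat, mapMatrix_gammaMat, mapMatrix_gammaMat]
    exact conjMat_mul _ _

theorem mapMatrix_gammaRep (g : gammaSubgroup) :
    toComplex.mapMatrix (gammaRep g) = conjMat g.1 :=
  mapMatrix_gammaMat g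

theorem toComplex_gammaRep (g : gammaSubgroup) (i j : Fin 3) :
    toComplex (gammaRep g i j) = conjMat g.1 i j := by
  rw [← mapMatrix_gammaRep]; rfl

theorem gammaRep_eq {g : gammaSubgroup} {N : Matrix (Fin 3) (Fin 3) GaussianInt}
    (h : toComplex.mapMatrix N = conjMat g.1) : gammaRep g = N :=
  mapMatrix_toComplex_injective (by rw [h, mapMatrix_gammaRep])

theorem gammaRep_inv (g : gammaSubgroup) : gammaRep g⁻¹ = (gammaRep g)ᵀ := by
  apply gammaRep_eq
  rw [Subgroup.coe_inv, conjMat_inv, ← mapMatrix_gammaRep]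
  rfl

/-- The reduction of `gammaRep` modulo `1 + i`. -/
def gammaRed : gammaSubgroup →* Matrix (Fin 3) (Fin 3) (ZMod 2) :=
  parity.mapMatrix.toMonoidHom.comp gammaRep

theorem gammaRed_apply (g : gammaSubgroup) (i j : Fin 3) :
    gammaRed g i j = parity (gammaRep g i j) := rfl

theorem gammaRed_inv (g : gammaSubgroup) : gammaRed g⁻¹ = (gammaRed g)ᵀ := by
  ext i j
  rw [gammaRed_apply, gammaRep_inv]; rfl

theorem gammaRed_mul_transpose (g : gammaSubgroup) : gammaRed g * (gammaRed g)ᵀ = 1 := by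
  rw [← gammaRed_inv, ← map_mul, mul_inv_cancel, map_one]

theorem transpose_mul_gammaRed (g : gammaSubgroup) : (gammaRed g)ᵀ * gammaRed g = 1 := by
  rw [← gammaRed_inv, ← map_mul, inv_mul_cancel, map_one]

set_option synthInstance.maxSize 1000 in
set_option synthInstance.maxHeartbeats 200000 in
/-- Over `𝔽₂`, the last column of an orthogonal `3 × 3` matrix is a standard basis vector. -/
theorem last_column_orthogonal {R : Matrix (Fin 3) (Fin 3) (ZMod 2)} (h : Rᵀ * R = 1) :
    (R 0 2 = 0 ∧ R 1 2 = 0 ∧ R 2 2 = 1) ∨ (R 0 2 = 1 ∧ R 1 2 = 0 ∧ R 2 2 = 0) ∨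
      (R 0 2 = 0 ∧ R 1 2 = 1 ∧ R 2 2 = 0) := by
  have h00 := congrFun (congrFun h 0) 0
  have h02 := congrFun (congrFun h 0) 2
  have h22 := congrFun (congrFun h 2) 2
  simp only [Matrix.mul_apply, Fin.sum_univ_three, transpose_apply, Matrix.one_apply,
    Fin.isValue, Fin.reduceEq, reduceIte] at h00 h02 h22
  generalize R 0 0 = a, R 1 0 = b, R 2 0 = c, R 0 2 = d, R 1 2 = e, R 2 2 = f at *
  revert a b c d e f
  decide

theorem block_orthogonal {R : Matrix (Fin 3) (Fin 3) (ZMod 2)} (h : R * Rᵀ = 1) (h' : Rᵀ * R = 1)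
    (h0 : R 0 2 = 0) (h1 : R 1 2 = 0) :
    R 2 0 = 0 ∧ R 2 1 = 0 ∧ R 2 2 = 1 ∧ R 0 0 + R 0 1 = 1 ∧ R 1 0 + R 1 1 = 1 := by
  have r00 := congrFun (congrFun h 0) 0
  have r11 := congrFun (congrFun h 1) 1
  have c02 := congrFun (congrFun h' 0) 2
  have c12 := congrFun (congrFun h' 1) 2
  have c22 := congrFun (congrFun h' 2) 2
  simp [Matrix.mul_apply, Fin.sum_univ_three, h0, h1] at r00 r11 c02 c12 c22
  generalize R 0 0 = a, R 0 1 = b, R 1 0 = c, R 1 1 = d, R 2 0 = e, R 2 1 = f, R 2 2 = k at *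
  subst c22
  have sq2 (x : ZMod 2) : x * x = x := by revert x; decide
  simp only [sq2] at r00 r11
  simp_all

/-- The stabilizer in `Γ'` of the third coordinate axis modulo `1 + i`. -/
def axisStabilizer : Subgroup gammaSubgroup where
  carrier := {g | gammaRed g 0 2 = 0 ∧ gammaRed g 1 2 = 0}
  one_mem' := by simp
  mul_mem' {g h} hg hh := by
    simp only [Set.mem_ofPred_eq, map_mul, Matrix.mul_apply, Fin.sum_univ_three] at *
    simp [hg, hh]
  inv_mem' {g} hg := by
    have := block_orthogonal (gammaRed_mul_transpose g) (transpose_mul_gammaRed g) hg.1 hg.2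
    simp only [Set.mem_ofPred_eq, gammaRed_inv, transpose_apply]
    exact ⟨this.1, this.2.1⟩

theorem mem_axisStabilizer {g : gammaSubgroup} :
    g ∈ axisStabilizer ↔ gammaRed g 0 2 = 0 ∧ gammaRed g 1 2 = 0 := Iff.rfl

theorem exists_mem_gammaSubgroup (g : SpecialLinearGroup (Fin 2) ℂ)
    (N : Matrix (Fin 3) (Fin 3) GaussianInt) (h : conjMat g = toComplex.mapMatrix N) :
    ∃ γ : gammaSubgroup, γ.1 = g ∧ gammaRed γ = parity.mapMatrix N :=
  ⟨⟨g, mem_gammaSubgroup_iff.2 ⟨N, h.symm⟩⟩, rfl,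
    congrArg parity.mapMatrix (gammaRep_eq h.symm)⟩

theorem exists_sq_eq (z : ℂ) : ∃ w : ℂ, w ^ 2 = z := IsAlgClosed.exists_pow_nat_eq z two_pos

theorem exists_swap_first_last :
    ∃ γ : gammaSubgroup, gammaRed γ = !![0, 0, 1; 0, 1, 0; 1, 0, 0] := by
  obtain ⟨w, hw⟩ := exists_sq_eq 2
  obtain ⟨γ, -, hγ⟩ := exists_mem_gammaSubgroup
    ⟨!![w / 2, w / 2; -w / 2, w / 2], by rw [det_fin_two_of]; linear_combination hw / 2⟩
    !![0, 0, -1; 0, 1, 0; 1, 0, 0] (by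
      ext i j
      fin_cases i <;> fin_cases j <;> simp [conjMat] <;> ring_nf <;> simp [hw]; norm_num)
  refine ⟨γ, hγ.trans ?_⟩
  ext i j
  fin_cases i <;> fin_cases j <;> simp

theorem exists_swap_middle_last :
    ∃ γ : gammaSubgroup, gammaRed γ = !![1, 0, 0; 0, 0, 1; 0, 1, 0] := by
  obtain ⟨w, hw⟩ := exists_sq_eq 2
  obtain ⟨γ, -, hγ⟩ := exists_mem_gammaSubgroup
    ⟨!![w / 2, I * w / 2; I * w / 2, w / 2], by
      rw [det_fin_two_of]; linear_combination hw / 2 - w ^ 2 / 4 * I_sq⟩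
    !![1, 0, 0; 0, 0, -1; 0, 1, 0] (by
      ext i j
      fin_cases i <;> fin_cases j <;> simp [conjMat] <;> ring_nf <;> simp [hw] <;> norm_num)
  refine ⟨γ, hγ.trans ?_⟩
  ext i j
  fin_cases i <;> fin_cases j <;> simp

theorem axisStabilizer_index : axisStabilizer.index = 3 := by
  obtain ⟨s, hs⟩ := exists_swap_first_last
  obtain ⟨t, ht⟩ := exists_swap_middle_last
  rw [index_eq_natCard_of_existsUnique _ ![1, s⁻¹, t⁻¹], Nat.card_eq_fintype_card, Fintype.card_fin]
  intro g
  have h0 : (![1, s⁻¹, t⁻¹] 0)⁻¹ * g ∈ axisStabilizer ↔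
      gammaRed g 0 2 = 0 ∧ gammaRed g 1 2 = 0 := by
    simp [mem_axisStabilizer]
  have h1 : (![1, s⁻¹, t⁻¹] 1)⁻¹ * g ∈ axisStabilizer ↔
      gammaRed g 2 2 = 0 ∧ gammaRed g 1 2 = 0 := by
    simp [mem_axisStabilizer, hs, Matrix.mul_apply, Fin.sum_univ_three]
  have h2 : (![1, s⁻¹, t⁻¹] 2)⁻¹ * g ∈ axisStabilizer ↔
      gammaRed g 0 2 = 0 ∧ gammaRed g 2 2 = 0 := by
    simp [mem_axisStabilizer, ht, Matrix.mul_apply, Fin.sum_univ_three]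
  obtain h | h | h := last_column_orthogonal (transpose_mul_gammaRed g)
  · refine ⟨0, h0.2 ⟨h.1, h.2.1⟩, fun i hi ↦ ?_⟩
    fin_cases i
    · rfl
    · simpa [h] using h1.1 hi
    · simpa [h] using h2.1 hi
  · refine ⟨1, h1.2 ⟨h.2.2, h.2.1⟩, fun i hi ↦ ?_⟩
    fin_cases i
    · simpa [h] using h0.1 hi
    · rfl
    · simpa [h] using h2.1 hi
  · refine ⟨2, h2.2 ⟨h.1, h.2.2⟩, fun i hi ↦ ?_⟩
    fin_cases i
    · simpa [h] using h0.1 hi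
    · simpa [h] using h1.1 hi
    · rfl

theorem isGauss_mul_of_mem_axisStabilizer {g : gammaSubgroup} (hg : g ∈ axisStabilizer) :
    ∀ i j k l : Fin 2, IsGauss (g.1 i j * g.1 k l) := by
  have hdet : g.1 0 0 * g.1 1 1 - g.1 0 1 * g.1 1 0 = 1 := by
    rw [← det_fin_two]; exact g.1.det_coe
  obtain ⟨h20, h21, -, h0, h1⟩ :=
    block_orthogonal (gammaRed_mul_transpose g) (transpose_mul_gammaRed g) hg.1 hg.2
  have hN := toComplex_gammaRep g
  simp only [gammaRed_apply] at h20 h21 h0 h1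
  generalize gammaRep g = N at *
  have e00 := hN 0 0
  have e01 := hN 0 1
  have e02 := hN 0 2
  have e10 := hN 1 0
  have e11 := hN 1 1
  have e12 := hN 1 2
  have e20 := hN 2 0
  have e21 := hN 2 1
  have e22 := hN 2 2
  simp only [conjMat, of_apply, cons_val', cons_val_zero, cons_val_one, cons_val, cons_val_fin_one]
    at e00 e01 e02 e10 e11 e12 e20 e21 e22
  simp only [Fin.forall_fin_two]
  have G (x : GaussianInt) {z : ℂ} (h : z = toComplex x) : IsGauss z :=
    isGauss_iff.2 ⟨x, h.symm⟩
  generalize g.1 0 0 = a, g.1 0 1 = b, g.1 1 0 = c, g.1 1 1 = d at *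
  obtain ⟨ha, hc, hac⟩ := isGauss_of_odd (x := a) (y := c) (p := N 0 0 - imag * N 0 1)
    (q := N 1 1 + imag * N 1 0) (r := -N 2 0 + imag * N 2 1)
    (by
      simp only [map_sub, map_mul, toComplex_imag, e00, e01]
      linear_combination (a ^ 2 - c ^ 2 + b ^ 2 - d ^ 2) / 2 * I_sq)
    (by
      simp only [map_add, map_mul, toComplex_imag, e10, e11]
      linear_combination -(b ^ 2 + d ^ 2 - a ^ 2 - c ^ 2) / 2 * I_sq)
    (by
      simp only [map_add, map_neg, map_mul, toComplex_imag, e20, e21]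
      linear_combination (a * c + b * d) * I_sq)
    (by simp [CharTwo.sub_eq_add, h0]) (by simp [add_comm, h1]) (by simp [h20, h21])
  obtain ⟨hb, hd, hbd⟩ := isGauss_of_odd (x := b) (y := d) (p := -(N 0 0 + imag * N 0 1))
    (q := N 1 1 - imag * N 1 0) (r := N 2 0 + imag * N 2 1)
    (by
      simp only [map_neg, map_add, map_mul, toComplex_imag, e00, e01]
      linear_combination (a ^ 2 - c ^ 2 + b ^ 2 - d ^ 2) / 2 * I_sq)
    (by
      simp only [map_sub, map_mul, toComplex_imag, e10, e11]
      linear_combination (b ^ 2 + d ^ 2 - a ^ 2 - c ^ 2) / 2 * I_sq)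
    (by
      simp only [map_add, map_mul, toComplex_imag, e20, e21]
      linear_combination (a * c + b * d) * I_sq)
    (by rw [map_neg, CharTwo.neg_eq]; simp [h0])
    (by simp [CharTwo.sub_eq_add, add_comm, h1]) (by simp [h20, h21])
  have hab : IsGauss (a * b) := .of_two_mul_of_sq
    (G (-N 0 2 - imag * N 1 2) <| by
      simp only [map_sub, map_neg, map_mul, toComplex_imag, e02, e12]
      linear_combination (a * b + c * d) * I_sq)
    (mul_pow a b 2 ▸ ha.mul hb)
  have hcd : IsGauss (c * d) := .of_two_mul_of_sq
    (G (N 0 2 - imag * N 1 2) <| by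
      simp only [map_sub, map_mul, toComplex_imag, e02, e12]
      linear_combination (a * b + c * d) * I_sq)
    (mul_pow c d 2 ▸ hc.mul hd)
  have had : IsGauss (a * d) := .of_two_mul_of_sq
    (G (N 2 2 + 1) <| by
      simp only [map_add, map_one, e22]
      linear_combination hdet)
    (mul_pow a d 2 ▸ ha.mul hd)
  have hbc : IsGauss (b * c) := .of_two_mul_of_sq
    (G (N 2 2 - 1) <| by
      simp only [map_sub, map_one, e22]
      linear_combination -hdet)
    (mul_pow b c 2 ▸ hb.mul hc)
  rw [sq] at ha hb hc hd
  simp only [ha, hb, hc, hd, hab, hac, had, hbc, hbd, hcd, mul_comm b a, mul_comm c a,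
    mul_comm d a, mul_comm c b, mul_comm d b, mul_comm d c, and_self]

/-- The matrices over `𝔽₂` whose entries have sum zero form the subgroup
`{!![1, 0; 0, 1], !![0, 1; 1, 0]}` of `SL(2, 𝔽₂)`. -/
def swapSubgroup : Subgroup (SpecialLinearGroup (Fin 2) (ZMod 2)) where
  carrier := {h | h.1 0 0 + h.1 0 1 + h.1 1 0 + h.1 1 1 = 0}
  one_mem' := by decide
  mul_mem' := by simp only [Set.mem_ofPred_eq]; decide
  inv_mem' := by simp only [Set.mem_ofPred_eq]; decide

theorem mem_swapSubgroup {h : SpecialLinearGroup (Fin 2) (ZMod 2)} :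
    h ∈ swapSubgroup ↔ h.1 0 0 + h.1 0 1 + h.1 1 0 + h.1 1 1 = 0 := Iff.rfl

instance : DecidablePred (· ∈ swapSubgroup) := fun _ ↦ decidable_of_iff _ mem_swapSubgroup.symm

theorem swapSubgroup_index : swapSubgroup.index = 3 := by
  have h := swapSubgroup.card_mul_index
  have h6 : Nat.card (SpecialLinearGroup (Fin 2) (ZMod 2)) = 6 := by
    rw [Nat.card_eq_fintype_card]; decide
  have h2 : Nat.card swapSubgroup = 2 := by
    rw [Nat.card_eq_fintype_card]; decide
  rw [h6, h2] at h
  omega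

theorem swapSubgroup_pattern (a b c d : ZMod 2) (h : a * d - b * c = 1) :
    a + b + c + d = 0 ↔ (a = 1 ∧ b = 0 ∧ c = 0 ∧ d = 1) ∨ (a = 0 ∧ b = 1 ∧ c = 1 ∧ d = 0) := by
  revert a b c d
  decide

theorem map_parity_surjective :
    Function.Surjective (Matrix.SpecialLinearGroup.map (n := Fin 2) parity) := by
  have hdet : ∀ h : SpecialLinearGroup (Fin 2) (ZMod 2),
      (!![((h.1 0 0).val : ℤ), -((h.1 0 1).val : ℤ);
          ((h.1 1 0).val : ℤ), ((h.1 1 1).val : ℤ)]).det = 1 := by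
    simp only [det_fin_two_of]; decide
  intro h
  refine ⟨Matrix.SpecialLinearGroup.map (Int.castRingHom GaussianInt) ⟨_, hdet h⟩, ?_⟩
  ext i j
  change parity (Int.castRingHom GaussianInt _) = _
  rw [eq_intCast, map_intCast]
  fin_cases i <;> fin_cases j <;> simp [CharTwo.neg_eq]

/-- The map `SL(2, ℤ[i]) → SL(2, ℂ)`. -/
def slToComplex : SpecialLinearGroup (Fin 2) GaussianInt →* SpecialLinearGroup (Fin 2) ℂ :=
  Matrix.SpecialLinearGroup.map toComplex

theorem slToComplex_apply (x : SpecialLinearGroup (Fin 2) GaussianInt) (i j : Fin 2) :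
    (slToComplex x).1 i j = toComplex (x.1 i j) := rfl

theorem slToComplex_injective : Function.Injective slToComplex := fun _ _ h ↦
  Matrix.SpecialLinearGroup.ext _ _ fun i j ↦
    toComplex_injective (congrArg (fun g ↦ g.1 i j) h)

theorem exists_slToComplex_eq {g : SpecialLinearGroup (Fin 2) ℂ} (hg : ∀ i j, IsGauss (g.1 i j)) :
    ∃ x, slToComplex x = g := by
  choose x hx using fun i j ↦ isGauss_iff.1 (hg i j)
  have hx' : toComplex.mapMatrix (of x) = g.1 := by ext i j; exact hx i j
  refine ⟨⟨of x, toComplex_injective ?_⟩, Subtype.ext hx'⟩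
  rw [RingHom.map_det, hx', g.2, map_one]

theorem coe_range_slToComplex :
    (slToComplex.range : Set (SpecialLinearGroup (Fin 2) ℂ)) = SL2ZiSL := by
  ext g
  refine ⟨?_, fun hg ↦ exists_slToComplex_eq hg⟩
  rintro ⟨x, rfl⟩ i j
  exact isGauss_toComplex _

/-- The subgroup `Ξ₁₂` of `SL(2,ℂ)`. -/
def xiSubgroup : Subgroup (SpecialLinearGroup (Fin 2) ℂ) :=
  (swapSubgroup.comap (Matrix.SpecialLinearGroup.map parity)).map slToComplex

theorem slToComplex_mem_xiSubgroup {x : SpecialLinearGroup (Fin 2) GaussianInt} :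
    slToComplex x ∈ xiSubgroup ↔ parity (x.1 0 0 + x.1 0 1 + x.1 1 0 + x.1 1 1) = 0 := by
  rw [xiSubgroup, Subgroup.mem_map_iff_mem slToComplex_injective, Subgroup.mem_comap,
    mem_swapSubgroup]
  simp only [map_add]
  rfl

theorem parity_det (x : SpecialLinearGroup (Fin 2) GaussianInt) :
    parity (x.1 0 0) * parity (x.1 1 1) - parity (x.1 0 1) * parity (x.1 1 0) = 1 := by
  rw [← map_mul, ← map_mul, ← map_sub, ← det_fin_two, x.2, map_one]

theorem coe_xiSubgroup : (xiSubgroup : Set (SpecialLinearGroup (Fin 2) ℂ)) = Xi12SL := by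
  have key (x : SpecialLinearGroup (Fin 2) GaussianInt) :
      slToComplex x ∈ xiSubgroup ↔ slToComplex x ∈ Xi12SL := by
    rw [slToComplex_mem_xiSubgroup, map_add, map_add, map_add,
      swapSubgroup_pattern _ _ _ _ (parity_det x), Xi12SL, Set.mem_ofPred_eq,
      and_iff_right (show ∀ i j, IsGauss ((slToComplex x).1 i j) from
        fun i j ↦ isGauss_toComplex _)]
    simp only [slToComplex_apply, gcong_toComplex_zero_iff, gcong_toComplex_one_iff]
  ext g
  constructor
  · rintro ⟨x, hx, rfl⟩
    exact (key x).1 ⟨x, hx, rfl⟩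
  · intro hg
    obtain ⟨x, rfl⟩ := exists_slToComplex_eq hg.1
    exact (key x).2 hg

theorem xiSubgroup_relIndex_range : xiSubgroup.relIndex slToComplex.range = 3 := by
  rw [xiSubgroup, MonoidHom.range_eq_map, Subgroup.relIndex_map_map_of_injective _ _
    slToComplex_injective, Subgroup.relIndex_top_right,
    Subgroup.index_comap_of_surjective _ map_parity_surjective, swapSubgroup_index]

theorem xiSubgroup_le_range : xiSubgroup ≤ slToComplex.range := by
  rw [MonoidHom.range_eq_map]
  exact Subgroup.map_mono le_top

theorem exists_mem_axisStabilizer_of_mem_xiSubgroup {g : SpecialLinearGroup (Fin 2) ℂ}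
    (hg : g ∈ xiSubgroup) :
    ∃ γ ∈ axisStabilizer, γ.1 = g := by
  obtain ⟨x, hx, rfl⟩ := hg
  replace hx := slToComplex_mem_xiSubgroup.1 (Subgroup.mem_map_of_mem slToComplex hx)
  obtain ⟨k, hk⟩ := parity_eq_zero_iff.1 hx
  have hp := hx
  simp only [map_add] at hp
  rw [swapSubgroup_pattern _ _ _ _ (parity_det x)] at hp
  have e00 := slToComplex_apply x 0 0
  have e01 := slToComplex_apply x 0 1
  have e10 := slToComplex_apply x 1 0
  have e11 := slToComplex_apply x 1 1
  generalize x.1 0 0 = a, x.1 0 1 = b, x.1 1 0 = c, x.1 1 1 = d at *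
  have hk := congrArg toComplex hk
  simp only [map_add, map_mul, map_one, toComplex_imag] at hk
  obtain ⟨m, hm⟩ : ∃ m, m = imag * k ^ 2 - (a * b + a * c + a * d + b * c + b * d + c * d) :=
    ⟨_, rfl⟩
  have hm2 : 2 * toComplex m =
      toComplex a ^ 2 + toComplex b ^ 2 + toComplex c ^ 2 + toComplex d ^ 2 := by
    simp only [hm, map_add, map_sub, map_mul, map_pow, toComplex_imag]
    linear_combination
      -(toComplex a + toComplex b + toComplex c + toComplex d + (1 + I) * toComplex k) * hk -
        toComplex k ^ 2 * I_sq
  obtain ⟨γ, hγ, hred⟩ := exists_mem_gammaSubgroup (slToComplex x)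
    !![m - c ^ 2 - b ^ 2, imag * (m - c ^ 2 - d ^ 2), c * d - a * b;
      imag * (m - a ^ 2 - c ^ 2), m, imag * (a * b + c * d);
      -(a * c) + b * d, -(imag * (a * c + b * d)), a * d + b * c] (by
      ext i j
      fin_cases i <;> fin_cases j <;> simp [conjMat, e00, e01, e10, e11]
      · linear_combination -hm2 / 2
      · linear_combination -I * hm2 / 2
      · linear_combination -I * hm2 / 2
      · linear_combination -hm2 / 2)
  refine ⟨γ, ?_, hγ⟩
  rw [mem_axisStabilizer, hred]
  obtain ⟨ha, hb, hc, hd⟩ | ⟨ha, hb, hc, hd⟩ := hp <;> simp [ha, hb, hc, hd]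

theorem xiSubgroup_le_gammaSubgroup : xiSubgroup ≤ gammaSubgroup := fun _ hg ↦ by
  obtain ⟨γ, -, rfl⟩ := exists_mem_axisStabilizer_of_mem_xiSubgroup hg
  exact γ.2

theorem mem_xiSubgroup_of_isGauss {g : SpecialLinearGroup (Fin 2) ℂ} (hg : g ∈ gammaSubgroup)
    (h : ∀ i j, IsGauss (g.1 i j)) : g ∈ xiSubgroup := by
  obtain ⟨N, hN⟩ := mem_gammaSubgroup_iff.1 hg
  obtain ⟨x, rfl⟩ := exists_slToComplex_eq h
  rw [slToComplex_mem_xiSubgroup]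
  have h11 : toComplex (N 1 1) = conjMat (slToComplex x) 1 1 := by rw [← hN]; rfl
  have hsq : x.1 0 0 ^ 2 + x.1 1 0 ^ 2 + x.1 0 1 ^ 2 + x.1 1 1 ^ 2 = 2 * N 1 1 := by
    apply toComplex_injective
    simp only [map_add, map_mul, map_pow, map_ofNat, h11, ← slToComplex_apply]
    simp [conjMat]
    ring
  replace hsq := congrArg parity hsq
  have hpow : ∀ p : ZMod 2, p ^ 2 = p := by decide
  simp only [map_add, map_pow, map_mul, parity_two, zero_mul, hpow] at hsq ⊢
  linear_combination hsq

theorem exists_coset_representative {ζ : ℂ} (hζ : ζ ^ 2 = I) :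
    ∃ γ ∈ axisStabilizer, γ.1.1 = !![ζ, 0; 0, -I * ζ] := by
  obtain ⟨γ, hγ, hred⟩ := exists_mem_gammaSubgroup
    ⟨!![ζ, 0; 0, -I * ζ], by rw [det_fin_two_of]; linear_combination -I * hζ - I_sq⟩
    !![0, -1, 0; 1, 0, 0; 0, 0, 1] (by
      ext i j
      fin_cases i <;> fin_cases j <;> simp [conjMat, mul_pow, hζ]
      · linear_combination I_sq
      · linear_combination -I_sq
      · linear_combination -I * hζ - I_sq)
  refine ⟨γ, ?_, congrArg Subtype.val hγ⟩
  rw [mem_axisStabilizer, hred]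
  simp

theorem xiSubgroup_relIndex_axisStabilizer :
    (xiSubgroup.subgroupOf gammaSubgroup).relIndex axisStabilizer = 2 := by
  obtain ⟨ζ, hζ⟩ := exists_sq_eq I
  obtain ⟨t, ht, htζ⟩ := exists_coset_representative hζ
  have htxi : t.1 ∉ xiSubgroup := by
    intro h
    have hG := (show t.1 ∈ Xi12SL by rw [← coe_xiSubgroup]; exact h).1 0 0
    rw [htζ] at hG
    simpa using isGauss_one.eq_zero_of_mul hζ isGauss_one (by simpa using hG)
  refine Subgroup.relIndex_eq_two_iff.2 ⟨t, ht, fun b hb ↦ ?_⟩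
  simp only [Subgroup.mem_subgroupOf, Subgroup.coe_mul]
  by_cases hbxi : b.1 ∈ xiSubgroup
  · exact Or.inr ⟨hbxi, fun h ↦ htxi ((xiSubgroup.mul_mem_cancel_left hbxi).1 h)⟩
  · refine Or.inl ⟨mem_xiSubgroup_of_isGauss (b * t).2 fun i j ↦ ?_, hbxi⟩
    have h := (entries_isGauss_or hζ b.1 (isGauss_mul_of_mem_axisStabilizer hb)).resolve_left
      fun h ↦ hbxi (mem_xiSubgroup_of_isGauss b.2 h)
    change IsGauss ((b.1.1 * t.1.1) i j)
    rw [htζ, Matrix.mul_apply, Fin.sum_univ_two]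
    obtain ⟨s, hs, hs'⟩ := h i 0
    obtain ⟨r, hr, hr'⟩ := h i 1
    change b.1.1 i 0 = _ at hs'
    change b.1.1 i 1 = _ at hr'
    rw [hs', hr']
    fin_cases j
    · convert isGauss_I.mul hs using 1
      simp
      linear_combination s * hζ
    · convert hr using 1
      simp
      linear_combination -I * r * hζ - r * I_sq

theorem xiSubgroup_relIndex_gammaSubgroup : xiSubgroup.relIndex gammaSubgroup = 6 := by
  have hle : xiSubgroup.subgroupOf gammaSubgroup ≤ axisStabilizer := fun g hg ↦ by
    obtain ⟨γ, hγ, h⟩ :=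
      exists_mem_axisStabilizer_of_mem_xiSubgroup (Subgroup.mem_subgroupOf.1 hg)
    rwa [← Subtype.ext h]
  rw [Subgroup.relIndex, ← Subgroup.relIndex_mul_index hle, xiSubgroup_relIndex_axisStabilizer,
    axisStabilizer_index]

/-- `Ξ₁₂` is a subgroup of both `Γ'` and `SL(2,ℤ[i])`; it has index `6` in `Γ'` and
index `3` in `SL(2,ℤ[i])`. -/
theorem stmt5 :
    ∃ K H₁ H₂ : Subgroup (Matrix.SpecialLinearGroup (Fin 2) ℂ),
      (K : Set (Matrix.SpecialLinearGroup (Fin 2) ℂ)) = Xi12SL ∧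
      (H₁ : Set (Matrix.SpecialLinearGroup (Fin 2) ℂ)) = GammaSL ∧
      (H₂ : Set (Matrix.SpecialLinearGroup (Fin 2) ℂ)) = SL2ZiSL ∧
      K ≤ H₁ ∧ K ≤ H₂ ∧
      (K.subgroupOf H₁).index = 6 ∧ (K.subgroupOf H₂).index = 3 :=
  ⟨xiSubgroup, gammaSubgroup, slToComplex.range, coe_xiSubgroup, rfl, coe_range_slToComplex,
    xiSubgroup_le_gammaSubgroup, xiSubgroup_le_range, xiSubgroup_relIndex_gammaSubgroup,
    xiSubgroup_relIndex_range⟩
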